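/- arXiv:1907.07138 — 6 statements merged into one kernel-verified Lean document; each statement's English description precedes it below -/
import Mathlib

section
/- For every natural number k, the even complex Clifford algebra ℂl_{2k} is isomorphic as a ℂ-algebra to the matrix algebra M_{2^k}(ℂ). -/
/-- The quadratic form `z₁² + ⋯ + z_n²` on `ℂⁿ`. -/
noncomputable def Qc (n : ℕ) : QuadraticForm ℂ (Fin n → ℂ) :=
  QuadraticMap.weightedSumSquares ℂ (fun _ : Fin n => (1 : ℂ))

open Module in
/-- A Clifford algebra of a quadratic form over a field of characteristic not two has dimension
`2 ^ n`, where `n` is the dimension of the underlying space. -/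
theorem CliffordAlgebra.finrank_eq_two_pow {K V : Type*} [Field K] [Invertible (2 : K)]
    [AddCommGroup V] [Module K V] [FiniteDimensional K V] (Q : QuadraticForm K V) :
    finrank K (CliffordAlgebra Q) = 2 ^ finrank K V := by
  rw [(CliffordAlgebra.equivExterior Q).finrank_eq,
    finrank_eq_card_basis (finBasis K V).ExteriorAlgebra, Fintype.card_finset, Fintype.card_fin]

theorem CliffordAlgebra.finiteDimensional {K V : Type*} [Field K] [Invertible (2 : K)]
    [AddCommGroup V] [Module K V] [FiniteDimensional K V] (Q : QuadraticForm K V) :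
    FiniteDimensional K (CliffordAlgebra Q) :=
  Module.finite_of_finrank_pos (by rw [CliffordAlgebra.finrank_eq_two_pow]; positivity)

theorem Qc_apply (n : ℕ) (x : Fin n → ℂ) : Qc n x = ∑ i, x i * x i := by
  simp [Qc, QuadraticMap.weightedSumSquares_apply]

/-- A subalgebra of block matrices which contains the off-diagonal matrix units and all upper left
blocks is everything. -/
theorem Matrix.mem_of_fromBlocks_mem {R ι : Type*} [CommRing R] [Fintype ι] [DecidableEq ι]
    (S : Subalgebra R (Matrix (ι ⊕ ι) (ι ⊕ ι) R))
    (hE : fromBlocks 0 1 0 0 ∈ S) (hF : fromBlocks 0 0 1 0 ∈ S)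
    (hA : ∀ A, fromBlocks A 0 0 0 ∈ S) (M : Matrix (ι ⊕ ι) (ι ⊕ ι) R) : M ∈ S := by
  have key : M = fromBlocks M.toBlocks₁₁ 0 0 0
      + fromBlocks M.toBlocks₁₂ 0 0 0 * fromBlocks 0 1 0 0
      + fromBlocks 0 0 1 0 * fromBlocks M.toBlocks₂₁ 0 0 0
      + fromBlocks 0 0 1 0 * fromBlocks M.toBlocks₂₂ 0 0 0 * fromBlocks 0 1 0 0 := by
    conv_lhs => rw [← fromBlocks_toBlocks M]
    simp [fromBlocks_multiply, fromBlocks_add]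
  rw [key]
  exact S.add_mem (S.add_mem (S.add_mem (hA _) (S.mul_mem (hA _) hE)) (S.mul_mem hF (hA _)))
    (S.mul_mem (S.mul_mem hF (hA _)) hE)

/-- A Clifford map from `ℂⁿ` into matrices extends to one from `ℂⁿ⁺²` into two-by-two
block matrices, by means of the Pauli matrices. -/
noncomputable def pauliExtend {n : ℕ} {ι : Type*} [DecidableEq ι]
    (g : (Fin n → ℂ) →ₗ[ℂ] Matrix ι ι ℂ) :
    (Fin (n + 2) → ℂ) →ₗ[ℂ] Matrix (ι ⊕ ι) (ι ⊕ ι) ℂ where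
  toFun x := Matrix.fromBlocks (g fun i => x i.succ.succ) ((x 0 - Complex.I * x 1) • 1)
    ((x 0 + Complex.I * x 1) • 1) (-g fun i => x i.succ.succ)
  map_add' x y := by
    have h : (fun i : Fin n => (x + y) i.succ.succ)
      = (fun i => x i.succ.succ) + fun i => y i.succ.succ := rfl
    rw [h, map_add, Matrix.fromBlocks_add]
    congr 1
    · rw [← add_smul]; congr 1; simp only [Pi.add_apply]; ring
    · rw [← add_smul]; congr 1; simp only [Pi.add_apply]; ring
    · abel
  map_smul' c x := by
    have h : (fun i : Fin n => (c • x) i.succ.succ) = c • fun i => x i.succ.succ := rfl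
    rw [h, map_smul, RingHom.id_apply, Matrix.fromBlocks_smul]
    congr 1
    · rw [smul_smul]; congr 1; simp only [Pi.smul_apply, smul_eq_mul]; ring
    · rw [smul_smul]; congr 1; simp only [Pi.smul_apply, smul_eq_mul]; ring
    · rw [smul_neg]

theorem pauliExtend_apply {n : ℕ} {ι : Type*} [DecidableEq ι]
    (g : (Fin n → ℂ) →ₗ[ℂ] Matrix ι ι ℂ) (x : Fin (n + 2) → ℂ) :
    pauliExtend g x = Matrix.fromBlocks (g fun i => x i.succ.succ)
      ((x 0 - Complex.I * x 1) • 1) ((x 0 + Complex.I * x 1) • 1)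
      (-g fun i => x i.succ.succ) := rfl

theorem pauliExtend_mul_self {n : ℕ} {ι : Type*} [Fintype ι] [DecidableEq ι]
    (g : (Fin n → ℂ) →ₗ[ℂ] Matrix ι ι ℂ)
    (hg : ∀ x, g x * g x = algebraMap ℂ (Matrix ι ι ℂ) (Qc n x)) (x : Fin (n + 2) → ℂ) :
    pauliExtend g x * pauliExtend g x
      = algebraMap ℂ (Matrix (ι ⊕ ι) (ι ⊕ ι) ℂ) (Qc (n + 2) x) := by
  have hQ : Qc (n + 2) x
      = Qc n (fun i => x i.succ.succ) + (x 0 - Complex.I * x 1) * (x 0 + Complex.I * x 1) := by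
    rw [Qc_apply, Qc_apply, Fin.sum_univ_succ, Fin.sum_univ_succ, Fin.succ_zero_eq_one]
    linear_combination (x 1 * x 1) * Complex.I_mul_I
  rw [pauliExtend_apply, Matrix.fromBlocks_multiply, hQ, Algebra.algebraMap_eq_smul_one,
    ← Matrix.fromBlocks_one, Matrix.fromBlocks_smul]
  congr 1
  · rw [hg, Algebra.algebraMap_eq_smul_one, smul_mul_smul_comm, one_mul, add_smul]
  · simp
  · simp
  · rw [neg_mul_neg, hg, Algebra.algebraMap_eq_smul_one, smul_mul_smul_comm, one_mul,
      mul_comm (x 0 + Complex.I * x 1), ← add_smul, add_comm]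

open CliffordAlgebra in
/-- A surjective matrix representation of `ℂl_n` yields one of `ℂl_{n+2}` of twice the size. -/
theorem exists_surjective_clifford_matrix_add_two {n : ℕ} {ι : Type*} [Fintype ι] [DecidableEq ι]
    (φ : CliffordAlgebra (Qc n) →ₐ[ℂ] Matrix ι ι ℂ) (hφ : Function.Surjective φ) :
    ∃ ψ : CliffordAlgebra (Qc (n + 2)) →ₐ[ℂ] Matrix (ι ⊕ ι) (ι ⊕ ι) ℂ,
      Function.Surjective ψ := by
  let g : (Fin n → ℂ) →ₗ[ℂ] Matrix ι ι ℂ := φ.toLinearMap ∘ₗ CliffordAlgebra.ι (Qc n)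
  have hg : ∀ x, g x * g x = algebraMap ℂ (Matrix ι ι ℂ) (Qc n x) := fun x => by
    simp [g, ← map_mul]
  let ψ := lift (Qc (n + 2)) ⟨pauliExtend g, pauliExtend_mul_self g hg⟩
  refine ⟨ψ, ?_⟩
  have hmem : ∀ a b x, Matrix.fromBlocks (g x) ((a - Complex.I * b) • 1)
      ((a + Complex.I * b) • 1) (-g x) ∈ ψ.range := fun a b x =>
    ⟨CliffordAlgebra.ι _ (Fin.cons a (Fin.cons b x)), by
      change ψ _ = _
      rw [lift_ι_apply, pauliExtend_apply]
      rfl⟩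
  have hI : Complex.I * (Complex.I / 2) = -(1 / 2) := by
    linear_combination Complex.I_mul_I / 2
  have hE : Matrix.fromBlocks 0 1 0 0 ∈ ψ.range := by
    have h := hmem (1 / 2) (Complex.I / 2) 0
    rw [hI, map_zero] at h
    norm_num at h
    exact h
  have hF : Matrix.fromBlocks 0 0 1 0 ∈ ψ.range := by
    have h := hmem (1 / 2) (-(Complex.I / 2)) 0
    rw [mul_neg, hI, map_zero] at h
    norm_num at h
    exact h
  have hEF : Matrix.fromBlocks 1 0 0 0 ∈ ψ.range := by
    simpa [Matrix.fromBlocks_multiply] using ψ.range.mul_mem hE hF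
  have hA : ∀ c, Matrix.fromBlocks (φ c) 0 0 0 ∈ ψ.range := fun c => by
    induction c using CliffordAlgebra.induction with
    | algebraMap r =>
      simpa [Matrix.fromBlocks_smul, Algebra.algebraMap_eq_smul_one] using
        ψ.range.smul_mem hEF r
    | ι x =>
      have h := ψ.range.mul_mem (ψ.range.mul_mem hEF (hmem 0 0 x)) hEF
      simpa [Matrix.fromBlocks_multiply, g] using h
    | mul a b ha hb =>
      simpa [Matrix.fromBlocks_multiply] using ψ.range.mul_mem ha hb
    | add a b ha hb =>
      simpa [Matrix.fromBlocks_add] using ψ.range.add_mem ha hb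
  exact fun M => Matrix.mem_of_fromBlocks_mem ψ.range hE hF
    (fun A => by obtain ⟨c, rfl⟩ := hφ A; exact hA c) M

theorem exists_surjective_clifford_matrix (k : ℕ) :
    ∃ (ι : Type) (_ : Fintype ι) (_ : DecidableEq ι), Fintype.card ι = 2 ^ k ∧
      ∃ φ : CliffordAlgebra (Qc (2 * k)) →ₐ[ℂ] Matrix ι ι ℂ, Function.Surjective φ := by
  induction k with
  | zero =>
    refine ⟨Unit, inferInstance, inferInstance, rfl,
      CliffordAlgebra.lift _ ⟨0, fun x => by simp [Qc_apply]⟩, fun M => ?_⟩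
    refine ⟨algebraMap ℂ _ (M () ()), ?_⟩
    rw [AlgHom.commutes]
    ext
    simp [Matrix.algebraMap_matrix_apply]
  | succ k ih =>
    obtain ⟨ι, _, _, hι, φ, hφ⟩ := ih
    refine ⟨ι ⊕ ι, inferInstance, inferInstance, ?_,
      exists_surjective_clifford_matrix_add_two φ hφ⟩
    rw [Fintype.card_sum, hι, pow_succ, mul_two]

/-- The even complex Clifford algebra `ℂl_{2k}` is isomorphic as a `ℂ`-algebra to
`M_{2^k}(ℂ)`. -/
theorem even_complex_clifford_iso_matrix (k : ℕ) :
    Nonempty (CliffordAlgebra (Qc (2 * k)) ≃ₐ[ℂ] Matrix (Fin (2 ^ k)) (Fin (2 ^ k)) ℂ) := by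
  obtain ⟨ι, _, _, hι, φ, hφ⟩ := exists_surjective_clifford_matrix k
  have := CliffordAlgebra.finiteDimensional (Qc (2 * k))
  have hdim : Module.finrank ℂ (CliffordAlgebra (Qc (2 * k)))
      = Module.finrank ℂ (Matrix ι ι ℂ) := by
    rw [CliffordAlgebra.finrank_eq_two_pow, Module.finrank_matrix, Module.finrank_self, hι,
      Module.finrank_fin_fun]
    ring
  have hinj : Function.Injective φ :=
    (LinearMap.injective_iff_surjective_of_finrank_eq_finrank (f := φ.toLinearMap) hdim).2 hφ
  exact ⟨(AlgEquiv.ofBijective φ ⟨hinj, hφ⟩).trans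
    (Matrix.reindexAlgEquiv ℂ ℂ (Fintype.equivFinOfCardEq hι))⟩
end

section
/- For all natural numbers p and q, the complexification ℂ ⊗_ℝ Cl_{p,q} of the real Clifford algebra Cl_{p,q} is isomorphic as a ℂ-algebra to the complex Clifford algebra ℂl_{p+q}. In particular, the complexified Clifford algebra depends only on p + q and not on the signature (p, q). -/
open scoped TensorProduct

/-- The quadratic form `Q_{p,q}(x) = x₁² + ⋯ + x_p² − x_{p+1}² − ⋯ − x_{p+q}²` on `ℝ^{p+q}`. -/
noncomputable def Qpq (p q : ℕ) : QuadraticForm ℝ (Fin (p + q) → ℝ) :=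
  QuadraticMap.weightedSumSquares ℝ (fun i : Fin (p + q) => if (i : ℕ) < p then (1 : ℝ) else -1)

/-- The base change of a diagonal quadratic form is the diagonal form with the same weights. -/
theorem QuadraticForm.baseChange_weightedSumSquares {R A ι : Type*} [CommRing R] [CommRing A]
    [Algebra R A] [Invertible (2 : R)] [Fintype ι] [DecidableEq ι] (w : ι → R) :
    QuadraticForm.baseChange A (QuadraticMap.weightedSumSquares R w) =
      (QuadraticMap.weightedSumSquares A fun i => algebraMap R A (w i)).comp
        (TensorProduct.piScalarRight R A A ι).toLinearMap := by
  refine baseChange_ext fun v => ?_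
  simp [QuadraticMap.weightedSumSquares_apply, Algebra.smul_def]

/-- The base change of a diagonal quadratic form is isometric to the diagonal form with the same
weights. -/
noncomputable def QuadraticForm.baseChangeWeightedSumSquaresEquiv {R ι : Type*} (A : Type*)
    [CommRing R] [CommRing A] [Algebra R A] [Invertible (2 : R)] [Fintype ι] [DecidableEq ι]
    (w : ι → R) :
    (QuadraticForm.baseChange A (QuadraticMap.weightedSumSquares R w)).IsometryEquiv
      (QuadraticMap.weightedSumSquares A fun i => algebraMap R A (w i)) where
  toLinearEquiv := TensorProduct.piScalarRight R A A ι
  map_app' x := by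
    rw [baseChange_weightedSumSquares]
    rfl

/-- The complexification `ℂ ⊗ℝ Cl_{p,q}` is isomorphic as a `ℂ`-algebra to the complex
Clifford algebra `ℂl_{p+q}`; in particular it depends only on `p + q`. -/
theorem complexified_clifford_iso (p q : ℕ) :
    Nonempty ((ℂ ⊗[ℝ] CliffordAlgebra (Qpq p q)) ≃ₐ[ℂ] CliffordAlgebra (Qc (p + q))) := by
  have hw : (fun i : Fin (p + q) => if algebraMap ℝ ℂ (if (i : ℕ) < p then 1 else -1) = 0
      then (0 : ℂ) else 1) = fun _ => 1 := by
    ext i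
    split_ifs <;> simp_all
  let e := (QuadraticForm.isometryEquivSumSquares (K := ℂ)
    fun i : Fin (p + q) => algebraMap ℝ ℂ (if (i : ℕ) < p then 1 else -1)).trans
      (QuadraticForm.weightedSumSquaresCongr hw)
  exact ⟨(CliffordAlgebra.equivBaseChange ℂ (Qpq p q)).symm.trans
    (CliffordAlgebra.equivOfIsometry
      ((QuadraticForm.baseChangeWeightedSumSquaresEquiv ℂ _).trans e))⟩
end

section
/- Restriction to the positive reals is an isomorphism of real algebras from C⁰(ℝ^{0,1} ∖ {0}) onto C₀((0,∞), ℂ). Precisely: let A be the set of continuous functions f : {x : ℝ | x ≠ 0} → ℂ vanishing at infinity (i.e. C₀ functions on the locally compact space ℝ ∖ {0}) which satisfy f(−x) = conj(f(x)) for all x ≠ 0; A is a (non-unital) ℝ-subalgebra, closed under the star operation, of the algebra of C₀ functions on ℝ ∖ {0} with values in ℂ. Then the map sending f ∈ A to its restriction to {x : ℝ | 0 < x} is a bijective, ℝ-linear, multiplicative and star-preserving map from A onto the algebra C₀((0,∞), ℂ) of continuous complex-valued functions on (0,∞) vanishing at infinity. -/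
open scoped ZeroAtInfty

/-- The locally compact space `ℝ ∖ {0}`, underlying the real space `ℝ^{0,1} ∖ {0}`. -/
abbrev RealMinusZero : Type := {x : ℝ // x ≠ 0}

/-- The positive half-line `(0, ∞)`. -/
abbrev PosReals : Type := {x : ℝ // 0 < x}

/-- `C⁰(ℝ^{0,1} ∖ {0})`: the set of `C₀` functions `f : ℝ ∖ {0} → ℂ` satisfying the reality
condition `f(−x) = conj (f x)`. -/
def realStructureFns : Set C₀(RealMinusZero, ℂ) :=
  {f | ∀ x : RealMinusZero, f ⟨-x.1, neg_ne_zero.mpr x.2⟩ = starRingEnd ℂ (f x)}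

/-- The inclusion of the positive reals into the nonzero reals, as a proper map. -/
def PosReals.inclusion : CocompactMap PosReals RealMinusZero where
  toFun x := ⟨x.1, x.2.ne'⟩
  continuous_toFun := by fun_prop
  cocompact_tendsto' := by
    have h : Function.LeftInverse (fun x : RealMinusZero => (⟨|x.1|, abs_pos.mpr x.2⟩ : PosReals))
        (fun x : PosReals => (⟨x.1, x.2.ne'⟩ : RealMinusZero)) :=
      fun x => Subtype.ext (abs_of_pos x.2)
    exact (h.isClosedEmbedding (by fun_prop) (by fun_prop)).tendsto_cocompact

/-- The absolute value, as a proper map from the nonzero reals to the positive reals. -/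
def RealMinusZero.absMap : CocompactMap RealMinusZero PosReals where
  toFun x := ⟨|x.1|, abs_pos.mpr x.2⟩
  continuous_toFun := by fun_prop
  cocompact_tendsto' := by
    intro s hs
    obtain ⟨K, hK, hKs⟩ := Filter.mem_cocompact.mp hs
    have hpos : Continuous (fun x : PosReals => (⟨x.1, x.2.ne'⟩ : RealMinusZero)) := by fun_prop
    have hneg : Continuous
        (fun x : PosReals => (⟨-x.1, neg_ne_zero.mpr x.2.ne'⟩ : RealMinusZero)) := by fun_prop
    refine Filter.mem_cocompact.mpr ⟨_, (hK.image hpos).union (hK.image hneg), fun x hx => ?_⟩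
    refine hKs fun hxK => hx ?_
    rcases abs_choice x.1 with h | h
    · exact Or.inl ⟨_, hxK, Subtype.ext h⟩
    · exact Or.inr ⟨_, hxK, Subtype.ext (neg_eq_iff_eq_neg.mpr h)⟩

theorem RealMinusZero.isClopen_pos : IsClopen {x : RealMinusZero | 0 < x.1} := by
  refine ⟨?_, isOpen_lt continuous_const continuous_subtype_val⟩
  have h : {x : RealMinusZero | 0 < x.1} = {x : RealMinusZero | 0 ≤ x.1} :=
    Set.ext fun x => by simpa using (le_iff_lt_or_eq.trans (or_iff_left x.2.symm)).symm
  rw [h]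
  exact isClosed_le continuous_const continuous_subtype_val

open Classical in
/-- The extension of a `C₀` function on `(0, ∞)` to `ℝ ∖ {0}` by `f (-x) = conj (f x)`. -/
noncomputable def PosReals.conjExtend (g : C₀(PosReals, ℂ)) : C₀(RealMinusZero, ℂ) where
  toFun x := if 0 < x.1 then g.comp RealMinusZero.absMap x
    else star (g.comp RealMinusZero.absMap) x
  continuous_toFun := by
    refine continuous_if (fun x hx => ?_) (map_continuous _).continuousOn
      (map_continuous _).continuousOn
    rw [RealMinusZero.isClopen_pos.frontier_eq] at hx
    exact hx.elim
  zero_at_infty' :=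
    (zero_at_infty (g.comp RealMinusZero.absMap)).if' (zero_at_infty _)

theorem PosReals.conjExtend_mem (g : C₀(PosReals, ℂ)) : conjExtend g ∈ realStructureFns := by
  intro x
  have habs : RealMinusZero.absMap ⟨-x.1, neg_ne_zero.mpr x.2⟩ = RealMinusZero.absMap x :=
    Subtype.ext (abs_neg x.1)
  change (if 0 < -x.1 then g (RealMinusZero.absMap _) else star (g (RealMinusZero.absMap _))) =
    star (if 0 < x.1 then g (RealMinusZero.absMap x) else star (g (RealMinusZero.absMap x)))
  rw [habs]
  rcases lt_or_gt_of_ne x.2 with h | h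
  · rw [if_pos (neg_pos.mpr h), if_neg h.not_gt, star_star]
  · rw [if_neg (neg_neg_of_pos h).not_gt, if_pos h]

theorem PosReals.conjExtend_comp_inclusion (g : C₀(PosReals, ℂ)) :
    (conjExtend g).comp inclusion = g := by
  ext x
  have habs : RealMinusZero.absMap (inclusion x) = x := Subtype.ext (abs_of_pos x.2)
  exact (if_pos x.2).trans (congrArg g habs)

theorem PosReals.injOn_comp_inclusion :
    Set.InjOn (fun f : C₀(RealMinusZero, ℂ) => f.comp inclusion) realStructureFns := by
  intro f hf g hg h
  have key (x : PosReals) : f ⟨x.1, x.2.ne'⟩ = g ⟨x.1, x.2.ne'⟩ := DFunLike.congr_fun h x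
  ext x
  rcases lt_or_gt_of_ne x.2 with hx | hx
  · refine (starRingEnd ℂ).injective ?_
    rw [← hf x, ← hg x]
    exact key ⟨-x.1, neg_pos.mpr hx⟩
  · exact key ⟨x.1, hx⟩

/-- `realStructureFns` is a non-unital star-closed `ℝ`-subalgebra of `C₀(ℝ ∖ {0}, ℂ)`, and
restriction to the positive reals is an `ℝ`-linear, multiplicative, star-preserving bijection
from it onto `C₀((0,∞), ℂ)`. -/
theorem restriction_to_positives_iso :
    (0 : C₀(RealMinusZero, ℂ)) ∈ realStructureFns ∧
    (∀ f g : C₀(RealMinusZero, ℂ),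
      f ∈ realStructureFns → g ∈ realStructureFns → f + g ∈ realStructureFns) ∧
    (∀ (r : ℝ) (f : C₀(RealMinusZero, ℂ)), f ∈ realStructureFns → r • f ∈ realStructureFns) ∧
    (∀ f g : C₀(RealMinusZero, ℂ),
      f ∈ realStructureFns → g ∈ realStructureFns → f * g ∈ realStructureFns) ∧
    (∀ f : C₀(RealMinusZero, ℂ), f ∈ realStructureFns → star f ∈ realStructureFns) ∧
    ∃ Φ : C₀(RealMinusZero, ℂ) → C₀(PosReals, ℂ),
      (∀ (f : C₀(RealMinusZero, ℂ)) (x : PosReals), Φ f x = f ⟨x.1, x.2.ne'⟩) ∧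
      (∀ f g, Φ (f + g) = Φ f + Φ g) ∧
      (∀ (r : ℝ) f, Φ (r • f) = r • Φ f) ∧
      (∀ f g, Φ (f * g) = Φ f * Φ g) ∧
      (∀ f, Φ (star f) = star (Φ f)) ∧
      Set.BijOn Φ realStructureFns Set.univ := by
  refine ⟨fun x => by simp, fun f g hf hg x => ?_, fun r f hf x => ?_, fun f g hf hg x => ?_,
    fun f hf x => ?_, fun f => f.comp PosReals.inclusion, fun _ _ => rfl, fun _ _ => rfl,
    fun _ _ => rfl, fun _ _ => rfl, fun _ => rfl, fun _ _ => Set.mem_univ _,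
    PosReals.injOn_comp_inclusion,
    fun g _ => ⟨PosReals.conjExtend g, PosReals.conjExtend_mem g,
      PosReals.conjExtend_comp_inclusion g⟩⟩
  · simp [hf x, hg x]
  · simp [hf x]
  · simp [hf x, hg x]
  · simp [hf x]
end

section
/- Let X be a compact Hausdorff topological space and τ : X → X a continuous involution (τ ∘ τ = id). Let A = C⁰(X, τ) = {f ∈ C(X, ℂ) : f(τ(x)) = conj(f(x)) for all x ∈ X}, which is a unital ℝ-subalgebra of the ℂ-algebra C(X, ℂ) of continuous complex-valued functions on X. Then the ℂ-algebra homomorphism ℂ ⊗_ℝ A → C(X, ℂ) determined by z ⊗ f ↦ z · f is bijective; that is, the complexification of C⁰(X, τ) is isomorphic as a ℂ-algebra to C(X, ℂ). -/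
open scoped TensorProduct

/-- Every element of `ℂ ⊗[ℝ] M` is of the form `1 ⊗ f + I ⊗ g`. -/
theorem exists_eq_one_tmul_add_I_tmul {M : Type*} [AddCommGroup M] [Module ℝ M]
    (t : ℂ ⊗[ℝ] M) :
    ∃ f g : M, t = (1 : ℂ) ⊗ₜ[ℝ] f + Complex.I ⊗ₜ[ℝ] g := by
  induction t with
  | zero => exact ⟨0, 0, by simp⟩
  | tmul z m =>
    refine ⟨z.re • m, z.im • m, ?_⟩
    rw [← TensorProduct.smul_tmul, ← TensorProduct.smul_tmul, ← TensorProduct.add_tmul]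
    congr 1
    apply Complex.ext <;> simp
  | add s t hs ht =>
    obtain ⟨f, g, rfl⟩ := hs
    obtain ⟨f', g', rfl⟩ := ht
    refine ⟨f + f', g + g', ?_⟩
    simp only [TensorProduct.tmul_add]
    abel

/-- The real algebra of continuous functions `f : X → ℂ` with `f ∘ τ = conj ∘ f`. -/
def realSpaceFunctions {X : Type*} [TopologicalSpace X] (τ : C(X, X)) :
    Subalgebra ℝ C(X, ℂ) where
  carrier := {f | ∀ x, f (τ x) = starRingEnd ℂ (f x)}
  mul_mem' hf hg x := by simp [hf x, hg x]
  add_mem' hf hg x := by simp [hf x, hg x]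
  algebraMap_mem' r x := by simp

section

variable {X : Type*} [TopologicalSpace X] {τ : C(X, X)}

theorem mem_realSpaceFunctions {f : C(X, ℂ)} :
    f ∈ realSpaceFunctions τ ↔ ∀ x, f (τ x) = starRingEnd ℂ (f x) :=
  Iff.rfl

theorem eq_zero_of_add_I_smul_eq_zero (hτ : ∀ x, τ (τ x) = x) {f g : C(X, ℂ)}
    (hf : f ∈ realSpaceFunctions τ) (hg : g ∈ realSpaceFunctions τ)
    (h : f + Complex.I • g = 0) : f = 0 ∧ g = 0 := by
  have key (x : X) : f x = 0 ∧ g x = 0 := by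
    have h₁ : f x + Complex.I * g x = 0 := by simpa using DFunLike.congr_fun h x
    have h₂ : f (τ x) + Complex.I * g (τ x) = 0 := by
      simpa using DFunLike.congr_fun h (τ x)
    have h₃ : f x - Complex.I * g x = 0 := by
      have := congrArg (starRingEnd ℂ) h₂
      rw [map_add, map_mul, ← hf, ← hg, hτ, Complex.conj_I, map_zero] at this
      linear_combination this
    have hfx : f x = 0 := by linear_combination (h₁ + h₃) / 2
    exact ⟨hfx, by simpa [hfx] using h₁⟩
  exact ⟨ContinuousMap.ext fun x => (key x).1, ContinuousMap.ext fun x => (key x).2⟩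

theorem exists_eq_add_I_smul (hτ : ∀ x, τ (τ x) = x) (h : C(X, ℂ)) :
    ∃ f ∈ realSpaceFunctions τ, ∃ g ∈ realSpaceFunctions τ, h = f + Complex.I • g := by
  let k : C(X, ℂ) := star (h.comp τ)
  have hk (x : X) : k x = starRingEnd ℂ (h (τ x)) := rfl
  refine ⟨(1 / 2 : ℂ) • (h + k), fun x => ?_, (-Complex.I / 2) • (h - k), fun x => ?_, ?_⟩
  · simp [hk, hτ, add_comm, Complex.conj_ofNat]
  · simp [hk, hτ, Complex.conj_ofNat]
    ring
  · ext x
    simp only [ContinuousMap.add_apply, ContinuousMap.smul_apply, ContinuousMap.sub_apply,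
      smul_eq_mul]
    linear_combination (h x - k x) / 2 * Complex.I_mul_I

end

/-- For a compact Hausdorff real space `(X, τ)`, the real algebra
`C⁰(X, τ) = {f : f ∘ τ = conj ∘ f}` is an `ℝ`-subalgebra of `C(X, ℂ)` whose complexification
is isomorphic, as a `ℂ`-algebra via `z ⊗ f ↦ z • f`, to `C(X, ℂ)`. -/
theorem complexification_of_real_space_functions
    (X : Type*) [TopologicalSpace X] [CompactSpace X] [T2Space X]
    (τ : C(X, X)) (hτ : ∀ x, τ (τ x) = x) :
    ∃ A : Subalgebra ℝ C(X, ℂ),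
      (A : Set C(X, ℂ)) = {f | ∀ x, f (τ x) = starRingEnd ℂ (f x)} ∧
      ∃ Φ : (ℂ ⊗[ℝ] A) →ₐ[ℂ] C(X, ℂ),
        (∀ (z : ℂ) (f : A), Φ (z ⊗ₜ f) = z • (f : C(X, ℂ))) ∧
        Function.Bijective Φ := by
  let Φ : (ℂ ⊗[ℝ] realSpaceFunctions τ) →ₐ[ℂ] C(X, ℂ) :=
    Algebra.TensorProduct.lift (Algebra.ofId ℂ C(X, ℂ)) (realSpaceFunctions τ).val
      fun _ _ => Commute.all _ _
  have hΦ (z : ℂ) (f : realSpaceFunctions τ) : Φ (z ⊗ₜ f) = z • (f : C(X, ℂ)) := by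
    simp [Φ, Algebra.ofId_apply, Algebra.smul_def]
  refine ⟨realSpaceFunctions τ, rfl, Φ, hΦ, ?_, fun h => ?_⟩
  · rw [injective_iff_map_eq_zero]
    intro t ht
    obtain ⟨f, g, rfl⟩ := exists_eq_one_tmul_add_I_tmul t
    rw [map_add, hΦ, hΦ, one_smul] at ht
    obtain ⟨hf, hg⟩ := eq_zero_of_add_I_smul_eq_zero hτ f.2 g.2 ht
    obtain rfl : f = 0 := Subtype.ext hf
    obtain rfl : g = 0 := Subtype.ext hg
    simp
  · obtain ⟨f, hf, g, hg, rfl⟩ := exists_eq_add_I_smul hτ h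
    exact ⟨1 ⊗ₜ ⟨f, hf⟩ + Complex.I ⊗ₜ ⟨g, hg⟩, by rw [map_add, hΦ, hΦ, one_smul]⟩
end

section
/- Let G be a group, φ : U(1) → G an injective group homomorphism from the circle group, and T ∈ G an element such that T φ(z) T⁻¹ = φ(z⁻¹) for every z in the circle group (this is the twisted-extension condition: T 'conjugates' the central circle by complex conjugation, since conj(z) = z⁻¹ for |z| = 1). If T² lies in the image of φ, then T² = φ(1) = 1 or T² = φ(−1); in particular T⁴ = 1. (This is the dichotomy T² = ±1 distinguishing the two isomorphism classes of twisted extensions containing a time-reversal–type element.) -/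
/-- In a twisted extension, an element `T` conjugating the central circle `U(1)` by complex
conjugation (i.e. inversion) and with `T²` central in the circle satisfies `T² = φ(1) = 1` or
`T² = φ(−1)`; in particular `T⁴ = 1`. -/
theorem twisted_extension_dichotomy
    (G : Type*) [Group G] (φ : Circle →* G) (hφ : Function.Injective φ)
    (T : G) (hT : ∀ z : Circle, T * φ z * T⁻¹ = φ z⁻¹)
    (h2 : T ^ 2 ∈ Set.range φ) :
    (T ^ 2 = 1 ∨ ∃ w : Circle, (w : ℂ) = -1 ∧ T ^ 2 = φ w) ∧ T ^ 4 = 1 := by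
  obtain ⟨z, hz⟩ := h2
  have hinv : z = z⁻¹ := hφ <| by
    rw [← hT z, hz]
    group
  have hφsq : φ z * φ z = 1 := by
    rw [← map_mul, mul_eq_one_iff_eq_inv.mpr hinv, map_one]
  have hsq : (z : ℂ) * z = 1 := by
    rw [← Circle.coe_mul, mul_eq_one_iff_eq_inv.mpr hinv, Circle.coe_one]
  constructor
  · rcases mul_self_eq_one_iff.mp hsq with h | h
    · left
      rw [← hz, Circle.coe_eq_one.mp h, map_one]
    · exact Or.inr ⟨z, h, hz.symm⟩
  · rw [show 4 = 2 + 2 from rfl, pow_add, ← hz, hφsq]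
end

section
/- The boundary map of the Puppe sequence agrees with complexification up to homotopy: the map Φ∘I from the suspension of ℝ to the complex suspension algebra, given on f ∈ C₀((0,1), ℝ) by (Φ∘I)(f)(x) = 0 for 0 < x ≤ 1/2 and (Φ∘I)(f)(x) = f(2x − 1) for 1/2 ≤ x < 1 (viewing real values inside ℂ), is homotopic through star-algebra homomorphisms to the complexification inclusion f ↦ f (i.e. the map C₀((0,1), ℝ) → C₀((0,1), ℂ) induced by the inclusion ℝ ↪ ℂ). Precisely: both assignments define ℝ-algebra star homomorphisms ψ₀, ψ₁ : C₀((0,1), ℝ) → C₀((0,1), ℂ), and there exists an ℝ-algebra star homomorphism H : C₀((0,1), ℝ) → C([0,1], C₀((0,1), ℂ)) such that evaluation at 0 after H equals ψ₀ and evaluation at 1 after H equals ψ₁. -/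
open scoped ZeroAtInfty unitInterval

/-- The open unit interval `(0,1)`. -/
abbrev OpenUnitInterval : Type := {x : ℝ // 0 < x ∧ x < 1}

/-- A function vanishing at infinity on an open subspace extends continuously by zero. -/
theorem ZeroAtInftyContinuousMap.continuous_extend_zero {X Y E : Type*} [TopologicalSpace X]
    [TopologicalSpace Y] [T2Space Y] [TopologicalSpace E] [Zero E] {e : X → Y}
    (he : Topology.IsOpenEmbedding e) (f : C₀(X, E)) :
    Continuous (Function.extend e f 0) := by
  rw [continuous_iff_continuousAt]
  intro y
  by_cases hy : ∃ x, e x = y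
  · obtain ⟨x, rfl⟩ := hy
    rw [← he.continuousAt_iff, Function.extend_comp he.injective]
    exact f.continuous.continuousAt
  · rw [ContinuousAt, Function.extend_apply' _ _ _ hy]
    intro V hV
    obtain ⟨K, hK, hKV⟩ := Filter.mem_cocompact.1 (f.zero_at_infty' hV)
    have hKy : (e '' K)ᶜ ∈ nhds y := (hK.image he.continuous).isClosed.isOpen_compl.mem_nhds
      fun ⟨x, _, hx⟩ => hy ⟨x, hx⟩
    rw [Filter.mem_map]
    filter_upwards [hKy] with z hz
    by_cases hz' : ∃ x, e x = z
    · obtain ⟨x, rfl⟩ := hz'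
      rw [Set.mem_preimage, he.injective.extend_apply]
      exact hKV fun hx => hz ⟨x, hx, rfl⟩
    · rw [Set.mem_preimage, Function.extend_apply' _ _ _ hz']
      exact mem_of_mem_nhds hV

namespace OpenUnitInterval

/-- The restriction to `(0,1)` of a continuous function vanishing at both endpoints. -/
def restrictZeroAtInfty {E : Type*} [TopologicalSpace E] [Zero E] (g : ℝ → E)
    (hg : Continuous g) (h₀ : g 0 = 0) (h₁ : g 1 = 0) : C₀(OpenUnitInterval, E) where
  toFun x := g x
  continuous_toFun := hg.comp continuous_subtype_val
  zero_at_infty' := by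
    intro V hV
    obtain ⟨W, hWV, hW, hW₀⟩ := mem_nhds_iff.1 hV
    refine Filter.mem_cocompact.2 ⟨{x | g x.1 ∉ W}, ?_, fun x hx => hWV (not_not.1 hx)⟩
    have hc : IsCompact (Set.Icc (0 : ℝ) 1 ∩ g ⁻¹' Wᶜ) :=
      isCompact_Icc.inter_right (hW.isClosed_compl.preimage hg)
    rw [Subtype.isCompact_iff]
    convert hc using 1
    ext y
    constructor
    · rintro ⟨x, hx, rfl⟩
      exact ⟨⟨x.2.1.le, x.2.2.le⟩, hx⟩
    · rintro ⟨⟨hy₀, hy₁⟩, hy⟩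
      refine ⟨⟨y, hy₀.lt_of_ne ?_, hy₁.lt_of_ne ?_⟩, hy, rfl⟩
      · rintro rfl
        exact hy (h₀ ▸ hW₀)
      · rintro rfl
        exact hy (h₁ ▸ hW₀)

/-- The extension by zero of `f` to the real line. -/
noncomputable def extendZero (f : C₀(OpenUnitInterval, ℝ)) : ℝ → ℝ :=
  Function.extend Subtype.val f 0

theorem extendZero_of_mem (f : C₀(OpenUnitInterval, ℝ)) {y : ℝ} (hy : 0 < y ∧ y < 1) :
    extendZero f y = f ⟨y, hy⟩ :=
  Subtype.val_injective.extend_apply f 0 (⟨y, hy⟩ : OpenUnitInterval)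

theorem extendZero_of_notMem (f : C₀(OpenUnitInterval, ℝ)) {y : ℝ} (hy : ¬(0 < y ∧ y < 1)) :
    extendZero f y = 0 :=
  Function.extend_apply' _ _ _ fun ⟨x, hx⟩ => hy (hx ▸ x.2)

theorem continuous_extendZero (f : C₀(OpenUnitInterval, ℝ)) : Continuous (extendZero f) :=
  f.continuous_extend_zero
    (isOpen_Ioo (a := (0 : ℝ)) (b := 1)).isOpenEmbedding_subtypeVal

theorem uniformContinuous_extendZero (f : C₀(OpenUnitInterval, ℝ)) :
    UniformContinuous (extendZero f) :=
  (HasCompactSupport.intro (isCompact_Icc (a := (0 : ℝ)) (b := 1)) fun _ hy =>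
    extendZero_of_notMem f fun h => hy ⟨h.1.le, h.2.le⟩).uniformContinuous_of_continuous
    (continuous_extendZero f)

/-- The star homomorphism `f ↦ (x ↦ f (1 - (2 - t) * (1 - x)))`, where `f` is extended by zero. -/
noncomputable def stretch (t : unitInterval) :
    C₀(OpenUnitInterval, ℝ) →⋆ₙₐ[ℝ] C₀(OpenUnitInterval, ℂ) where
  toFun f := restrictZeroAtInfty (fun x => (extendZero f (1 - (2 - t) * (1 - x)) : ℂ))
    (Complex.continuous_ofReal.comp ((continuous_extendZero f).comp (by fun_prop)))
    (by
      rw [extendZero_of_notMem f fun h => by linarith [h.1, t.2.2], Complex.ofReal_zero])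
    (by rw [extendZero_of_notMem f fun h => by linarith [h.2], Complex.ofReal_zero])
  map_smul' c f := by
    ext x
    change ((extendZero (c • f) (1 - (2 - t) * (1 - x)) : ℝ) : ℂ) =
      c • ((extendZero f (1 - (2 - t) * (1 - x)) : ℝ) : ℂ)
    by_cases h : 0 < 1 - (2 - (t : ℝ)) * (1 - x) ∧ 1 - (2 - (t : ℝ)) * (1 - x) < 1
    · simp [extendZero_of_mem _ h]
    · simp [extendZero_of_notMem _ h]
  map_zero' := by
    ext x
    change ((extendZero 0 (1 - (2 - t) * (1 - x)) : ℝ) : ℂ) = 0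
    by_cases h : 0 < 1 - (2 - (t : ℝ)) * (1 - x) ∧ 1 - (2 - (t : ℝ)) * (1 - x) < 1
    · simp [extendZero_of_mem _ h]
    · simp [extendZero_of_notMem _ h]
  map_add' f g := by
    ext x
    change ((extendZero (f + g) (1 - (2 - t) * (1 - x)) : ℝ) : ℂ) =
      (extendZero f (1 - (2 - t) * (1 - x)) : ℝ) + (extendZero g (1 - (2 - t) * (1 - x)) : ℝ)
    by_cases h : 0 < 1 - (2 - (t : ℝ)) * (1 - x) ∧ 1 - (2 - (t : ℝ)) * (1 - x) < 1
    · simp [extendZero_of_mem _ h]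
    · simp [extendZero_of_notMem _ h]
  map_mul' f g := by
    ext x
    change ((extendZero (f * g) (1 - (2 - t) * (1 - x)) : ℝ) : ℂ) =
      (extendZero f (1 - (2 - t) * (1 - x)) : ℝ) * (extendZero g (1 - (2 - t) * (1 - x)) : ℝ)
    by_cases h : 0 < 1 - (2 - (t : ℝ)) * (1 - x) ∧ 1 - (2 - (t : ℝ)) * (1 - x) < 1
    · simp [extendZero_of_mem _ h]
    · simp [extendZero_of_notMem _ h]
  map_star' f := by
    ext x
    change ((extendZero (star f) (1 - (2 - t) * (1 - x)) : ℝ) : ℂ) =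
      star ((extendZero f (1 - (2 - t) * (1 - x)) : ℝ) : ℂ)
    by_cases h : 0 < 1 - (2 - (t : ℝ)) * (1 - x) ∧ 1 - (2 - (t : ℝ)) * (1 - x) < 1
    · simp [extendZero_of_mem _ h]
    · simp [extendZero_of_notMem _ h]

theorem stretch_apply (t : unitInterval) (f : C₀(OpenUnitInterval, ℝ)) (x : OpenUnitInterval) :
    stretch t f x = (extendZero f (1 - (2 - t) * (1 - x)) : ℂ) :=
  rfl

theorem continuous_stretch (f : C₀(OpenUnitInterval, ℝ)) :
    Continuous fun t => stretch t f := by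
  rw [continuous_iff_continuousAt]
  intro s
  rw [ContinuousAt, ZeroAtInftyContinuousMap.tendsto_iff_tendstoUniformly,
    Metric.tendstoUniformly_iff]
  intro ε hε
  obtain ⟨δ, hδ, h⟩ := Metric.uniformContinuous_iff.1 (uniformContinuous_extendZero f) ε hε
  filter_upwards [Metric.ball_mem_nhds s hδ] with t ht x
  rw [stretch_apply, stretch_apply, Complex.isometry_ofReal.dist_eq]
  refine h (lt_of_le_of_lt ?_ (Metric.mem_ball'.1 ht))
  rw [Subtype.dist_eq, Real.dist_eq, Real.dist_eq,
    show 1 - (2 - (s : ℝ)) * (1 - x) - (1 - (2 - (t : ℝ)) * (1 - x)) =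
      ((s : ℝ) - t) * (1 - x) by ring, abs_mul]
  exact mul_le_of_le_one_right (abs_nonneg _)
    (abs_le.2 ⟨by linarith [x.2.2], by linarith [x.2.1]⟩)

/-- The homomorphisms `stretch t` assembled into a homotopy. -/
noncomputable def stretchHomotopy :
    C₀(OpenUnitInterval, ℝ) →⋆ₙₐ[ℝ] C(unitInterval, C₀(OpenUnitInterval, ℂ)) where
  toFun f := ⟨fun t => stretch t f, continuous_stretch f⟩
  map_smul' c f := ContinuousMap.ext fun t => map_smul (stretch t) c f
  map_zero' := ContinuousMap.ext fun t => map_zero (stretch t)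
  map_add' f g := ContinuousMap.ext fun t => map_add (stretch t) f g
  map_mul' f g := ContinuousMap.ext fun t => map_mul (stretch t) f g
  map_star' f := ContinuousMap.ext fun t => map_star (stretch t) f

end OpenUnitInterval

/-- The Puppe boundary map `Φ ∘ I`, given by `f ↦ (x ↦ 0 for x ≤ 1/2, f(2x−1) for x ≥ 1/2)`,
is homotopic through real star-algebra homomorphisms to the complexification inclusion
`C₀((0,1), ℝ) → C₀((0,1), ℂ)`. -/
theorem puppe_boundary_homotopic_to_complexification :
    ∃ (ψ₀ ψ₁ : C₀(OpenUnitInterval, ℝ) →⋆ₙₐ[ℝ] C₀(OpenUnitInterval, ℂ))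
      (H : C₀(OpenUnitInterval, ℝ) →⋆ₙₐ[ℝ] C(unitInterval, C₀(OpenUnitInterval, ℂ))),
      (∀ (f : C₀(OpenUnitInterval, ℝ)) (x : OpenUnitInterval),
        x.1 ≤ 1 / 2 → ψ₀ f x = 0) ∧
      (∀ (f : C₀(OpenUnitInterval, ℝ)) (x : OpenUnitInterval) (h : 1 / 2 < x.1),
        ψ₀ f x = (f ⟨2 * x.1 - 1, by constructor <;> linarith [x.2.2]⟩ : ℂ)) ∧
      (∀ (f : C₀(OpenUnitInterval, ℝ)) (x : OpenUnitInterval), ψ₁ f x = (f x : ℂ)) ∧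
      (∀ f, (H f) 0 = ψ₀ f) ∧
      (∀ f, (H f) 1 = ψ₁ f) := by
  refine ⟨OpenUnitInterval.stretch 0, OpenUnitInterval.stretch 1,
    OpenUnitInterval.stretchHomotopy, fun f x hx => ?_, fun f x hx => ?_, fun f x => ?_,
    fun _ => rfl, fun _ => rfl⟩ <;> rw [OpenUnitInterval.stretch_apply]
  · rw [OpenUnitInterval.extendZero_of_notMem, Complex.ofReal_zero]
    rintro ⟨h, -⟩
    norm_num at h
    linarith
  · have h : 1 - (2 - ((0 : unitInterval) : ℝ)) * (1 - x) = 2 * x.1 - 1 := by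
      rw [Set.Icc.coe_zero]
      ring
    rw [h, OpenUnitInterval.extendZero_of_mem]
  · have h : 1 - (2 - ((1 : unitInterval) : ℝ)) * (1 - x) = x.1 := by
      rw [Set.Icc.coe_one]
      ring
    rw [h, OpenUnitInterval.extendZero_of_mem f x.2]
end
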